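/- arXiv:1301.0484 — 8 statements merged into one kernel-verified Lean document; each statement's English description precedes it below -/
import Mathlib

section
/- Let A be a commutative ring which is also a ℚ-algebra and let D : A → A be a derivation (write x' := D x). On the ℤ/2-graded module S := A ⊕ A, where the first summand (elements written e, f, g) is declared even and the second summand (elements written φ, ψ, χ) is declared odd, define a bracket by [e, f] := ef' − fe' (even), [e, φ] := −[φ, e] := eφ' − (1/2)e'φ (odd), and [φ, ψ] := φψ (even). Then S is a Lie superalgebra, i.e. for all elements x, y, z of pure parity the super-Jacobi identity (−1)^{x̄z̄}[x,[y,z]] + (−1)^{ȳx̄}[y,[z,x]] + (−1)^{z̄ȳ}[z,[x,y]] = 0 holds; explicitly: (i) the even part with [e,f] = ef' − fe' satisfies the Jacobi identity, (ii) [e,[f,φ]] − [f,[e,φ]] − [[e,f],φ] = 0, (iii) [e,[φ,ψ]] + [φ,[ψ,e]] − [ψ,[e,φ]] = 0, and (iv) [φ,[ψ,χ]] + [ψ,[χ,φ]] + [χ,[φ,ψ]] = 0. -/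
namespace KNSuper

variable {A : Type*} [CommRing A] [Algebra ℚ A]

/-- The even–even bracket `[e,f] = ef' − fe'` (vector fields). -/
def brEE (D : Derivation ℚ A A) (e f : A) : A := e * D f - f * D e

/-- The even–odd bracket `[e,φ] = e.φ = eφ' − ½e'φ` (action of vector fields on
−1/2-forms); the odd–even bracket is `[φ,e] := −[e,φ]`. -/
def brEO (D : Derivation ℚ A A) (e φ : A) : A := e * D φ - (1/2 : ℚ) • (D e * φ)

/-- The odd–odd bracket `[φ,ψ] = φψ` (product of −1/2-forms). -/
def brOO (φ ψ : A) : A := φ * ψ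

theorem brEO_eq (D : Derivation ℚ A A) (e φ : A) :
    brEO D e φ = e * D φ - algebraMap ℚ A (1/2) * (D e * φ) := by
  rw [brEO, Algebra.smul_def]

theorem two_mul_algebraMap_half : 2 * algebraMap ℚ A (1/2) = 1 := by
  rw [← map_ofNat (algebraMap ℚ A) 2, ← map_mul]
  norm_num

/-- `S = A ⊕ A` (even part: vector fields `e,f,g`; odd part: −1/2-forms `φ,ψ,χ`)
with the brackets `[e,f] = ef' − fe'`, `[e,φ] = −[φ,e] = eφ' − ½e'φ`,
`[φ,ψ] = φψ` is a Lie superalgebra, i.e. the super-Jacobi identity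
`(−1)^{x̄z̄}[x,[y,z]] + (−1)^{ȳx̄}[y,[z,x]] + (−1)^{z̄ȳ}[z,[x,y]] = 0` holds for
elements of pure parity; explicitly:
(i) the even part satisfies the Jacobi identity,
(ii) `[e,[f,φ]] − [f,[e,φ]] − [[e,f],φ] = 0`,
(iii) `[e,[φ,ψ]] + [φ,[ψ,e]] − [ψ,[e,φ]] = 0`,
(iv) `[φ,[ψ,χ]] + [ψ,[χ,φ]] + [χ,[φ,ψ]] = 0`. -/
theorem lieSuperalgebra_of_derivation (D : Derivation ℚ A A) :
    (∀ e f g : A,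
      brEE D e (brEE D f g) + brEE D f (brEE D g e) + brEE D g (brEE D e f) = 0) ∧
    (∀ e f φ : A,
      brEO D e (brEO D f φ) - brEO D f (brEO D e φ) - brEO D (brEE D e f) φ = 0) ∧
    (∀ e φ ψ : A,
      brEE D e (brOO φ ψ) + brOO φ (-(brEO D e ψ)) - brOO ψ (brEO D e φ) = 0) ∧
    (∀ φ ψ χ : A,
      (-(brEO D (brOO ψ χ) φ)) + (-(brEO D (brOO χ φ) ψ)) + (-(brEO D (brOO φ ψ) χ)) = 0) := by
  have half := two_mul_algebraMap_half (A := A)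
  refine ⟨fun e f g => ?_, fun e f φ => ?_, fun e φ ψ => ?_, fun φ ψ χ => ?_⟩
  · simp only [brEE, map_sub, Derivation.leibniz, smul_eq_mul]
    ring
  · simp only [brEO_eq, brEE, map_sub, Derivation.leibniz, Derivation.map_algebraMap, smul_eq_mul]
    ring
  · simp only [brEO_eq, brEE, brOO, Derivation.leibniz, smul_eq_mul]
    linear_combination (D e * φ * ψ) * half
  · simp only [brEO_eq, brOO, Derivation.leibniz, smul_eq_mul]
    linear_combination (D φ * ψ * χ + φ * D ψ * χ + φ * ψ * D χ) * half

end KNSuper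
end

section
/- Let A be a commutative ring which is also a ℚ-algebra and let D : A → A be a derivation (write x' := D x). Then for all e, φ, ψ ∈ A: e'''(φψ) − 2φ'·D(eψ' − (1/2)e'ψ) − 2ψ'·D(eφ' − (1/2)e'φ) = D( e''(φψ) − 2eφ'ψ' ). In particular the left-hand side is an exact element (the derivative of an explicit element), which is the key computation showing that the super-cocycle condition c(e,[φ,ψ]) − c(φ, e.ψ) − c(ψ, e.φ) = 0 holds for the geometric cocycle of the Krichever–Novikov superalgebra. -/
/-- The key computation for the super-cocycle condition of the geometric cocycle
of the Krichever–Novikov superalgebra: in a commutative ℚ-algebra `A` with a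
derivation `D` (writing `x' := D x`),
`e'''(φψ) − 2φ'·D(eψ' − ½e'ψ) − 2ψ'·D(eφ' − ½e'φ) = D(e''(φψ) − 2eφ'ψ')`,
so the left-hand side is an exact element. -/
theorem supercocycle_integrand_exact (A : Type*) [CommRing A] [Algebra ℚ A]
    (D : Derivation ℚ A A) (e φ ψ : A) :
    D (D (D e)) * (φ * ψ)
      - 2 * (D φ * D (e * D ψ - (1/2 : ℚ) • (D e * ψ)))
      - 2 * (D ψ * D (e * D φ - (1/2 : ℚ) • (D e * φ)))
    = D (D (D e) * (φ * ψ) - 2 * (e * D φ * D ψ)) := by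
  have half : 2 * algebraMap ℚ A (1 / 2) = 1 := by
    rw [← map_ofNat (algebraMap ℚ A) 2, ← map_mul]
    norm_num
  simp only [two_mul (e * D φ * D ψ), map_sub, map_add, Derivation.leibniz,
    Derivation.map_algebraMap, smul_eq_mul, Algebra.smul_def (1 / 2 : ℚ)]
  linear_combination
    (D φ * (D (D e) * ψ + D e * D ψ) + D ψ * (D (D e) * φ + D e * D φ)) * half
end

section
/- Let U, V ⊆ ℂ be open, h : U → V holomorphic with h'(z) ≠ 0 for all z ∈ U, and let e, f, R : V → ℂ be holomorphic. Define on U: ê := (e∘h)/h', f̂ := (f∘h)/h', and R̂ := (R∘h)·(h')² − S(h), where S(h) := h'''/h' − (3/2)(h''/h')² is the Schwarzian derivative. Then for every z ∈ U: (1/2)(ê'''(z)f̂(z) − ê(z)f̂'''(z)) − R̂(z)(ê'(z)f̂(z) − ê(z)f̂'(z)) = [ (1/2)(e'''f − ef''') − R(e'f − ef') ](h(z)) · h'(z). That is, the integrand of the vector field cocycle Φ_{C,R}(e,f) transforms as a differential under holomorphic coordinate change, so Φ_{C,R} is well defined. -/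
/-- First and third derivatives of the transform `(e ∘ h) / h'` of a vector field `e` under a
coordinate change `h`. -/
lemma deriv_comp_div_deriv {U V : Set ℂ} (hU : IsOpen U) (hV : IsOpen V) {h e : ℂ → ℂ}
    (hh : DifferentiableOn ℂ h U) (hmaps : Set.MapsTo h U V) (hh' : ∀ z ∈ U, deriv h z ≠ 0)
    (he : DifferentiableOn ℂ e V) {z : ℂ} (hz : z ∈ U) :
    deriv (fun w => e (h w) / deriv h w) z
        = deriv e (h z) - e (h z) * deriv^[2] h z / deriv h z ^ 2 ∧
      deriv^[3] (fun w => e (h w) / deriv h w) z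
        = deriv^[3] e (h z) * deriv h z ^ 2
          - deriv e (h z) *
            (2 * deriv^[3] h z / deriv h z - 3 * deriv^[2] h z ^ 2 / deriv h z ^ 2)
          - e (h z) * (deriv^[4] h z / deriv h z ^ 2
            - 6 * deriv^[2] h z * deriv^[3] h z / deriv h z ^ 3
            + 6 * deriv^[2] h z ^ 3 / deriv h z ^ 4) := by
  have iter_h (n : ℕ) {w : ℂ} (hw : w ∈ U) :
      HasDerivAt (deriv^[n] h) (deriv^[n + 1] h w) w := by
    rw [Function.iterate_succ_apply']
    exact (((hh.analyticOnNhd hU).iterated_deriv n) w hw).differentiableAt.hasDerivAt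
  have iter_e (n : ℕ) {w : ℂ} (hw : w ∈ U) :
      HasDerivAt (fun w => deriv^[n] e (h w)) (deriv^[n + 1] e (h w) * deriv h w) w := by
    rw [Function.iterate_succ_apply']
    exact (((he.analyticOnNhd hV).iterated_deriv n) (h w)
      (hmaps hw)).differentiableAt.hasDerivAt.comp w (iter_h 0 hw)
  have first : ∀ w ∈ U, deriv (fun w => e (h w) / deriv h w) w
      = deriv e (h w) - e (h w) * deriv^[2] h w / deriv h w ^ 2 := by
    intro w hw
    have hp := hh' w hw
    refine ((iter_e 0 hw).div (iter_h 1 hw) hp).deriv.trans ?_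
    simp only [Function.iterate_succ, Function.iterate_zero, Function.comp_apply, id]
    field_simp
  have second : ∀ w ∈ U, deriv (deriv (fun w => e (h w) / deriv h w)) w
      = deriv^[2] e (h w) * deriv h w - deriv e (h w) * deriv^[2] h w / deriv h w
        - e (h w) * (deriv^[3] h w / deriv h w ^ 2 - 2 * deriv^[2] h w ^ 2 / deriv h w ^ 3) := by
    intro w hw
    have hp := hh' w hw
    rw [(Filter.eventuallyEq_of_mem (hU.mem_nhds hw) first).deriv_eq]
    refine ((iter_e 1 hw).sub (((iter_e 0 hw).mul (iter_h 2 hw)).div ((iter_h 1 hw).pow 2)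
      (pow_ne_zero 2 hp))).deriv.trans ?_
    simp only [Function.iterate_succ, Function.iterate_zero, Function.comp_apply, id, Pi.mul_apply,
      Pi.pow_apply]
    field_simp
    ring
  refine ⟨first z hz, ?_⟩
  have hp := hh' z hz
  change deriv (deriv (deriv (fun w => e (h w) / deriv h w))) z = _
  rw [(Filter.eventuallyEq_of_mem (hU.mem_nhds hz) second).deriv_eq]
  refine ((((iter_e 2 hz).mul (iter_h 1 hz)).sub
    (((iter_e 1 hz).mul (iter_h 2 hz)).div (iter_h 1 hz) hp)).sub
    ((iter_e 0 hz).mul (((iter_h 3 hz).div ((iter_h 1 hz).pow 2) (pow_ne_zero 2 hp)).sub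
      ((((iter_h 2 hz).pow 2).const_mul 2).div ((iter_h 1 hz).pow 3)
        (pow_ne_zero 3 hp))))).deriv.trans ?_
  simp only [Function.iterate_succ, Function.iterate_zero, Function.comp_apply, id, Pi.mul_apply,
    Pi.pow_apply, Pi.div_apply, Pi.sub_apply]
  field_simp
  ring

/-- The integrand of the vector field cocycle `Φ_{C,R}(e,f)` transforms as a
differential under a holomorphic coordinate change `h` with nonvanishing
derivative: with `ê = (e∘h)/h'`, `f̂ = (f∘h)/h'` and
`R̂ = (R∘h)·(h')² − S(h)` (`S(h) = h'''/h' − (3/2)(h''/h')²` the Schwarzian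
derivative), one has
`½(ê'''f̂ − êf̂''') − R̂(ê'f̂ − êf̂') = [½(e'''f − ef''') − R(e'f − ef')]∘h · h'`. -/
theorem vectorField_cocycle_integrand_welldefined
    (U V : Set ℂ) (hU : IsOpen U) (hV : IsOpen V)
    (h e f R : ℂ → ℂ)
    (hh : DifferentiableOn ℂ h U) (hmaps : Set.MapsTo h U V)
    (hh' : ∀ z ∈ U, deriv h z ≠ 0)
    (he : DifferentiableOn ℂ e V) (hf : DifferentiableOn ℂ f V)
    (hR : DifferentiableOn ℂ R V) :
    let eh : ℂ → ℂ := fun w => e (h w) / deriv h w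
    let fh : ℂ → ℂ := fun w => f (h w) / deriv h w
    let Sh : ℂ → ℂ := fun w =>
      deriv^[3] h w / deriv h w - (3/2 : ℂ) * (deriv^[2] h w / deriv h w) ^ 2
    let Rh : ℂ → ℂ := fun w => R (h w) * (deriv h w) ^ 2 - Sh w
    ∀ z ∈ U,
      (1/2 : ℂ) * (deriv^[3] eh z * fh z - eh z * deriv^[3] fh z)
        - Rh z * (deriv eh z * fh z - eh z * deriv fh z)
      = ((1/2 : ℂ) * (deriv^[3] e (h z) * f (h z) - e (h z) * deriv^[3] f (h z))
          - R (h z) * (deriv e (h z) * f (h z) - e (h z) * deriv f (h z))) * deriv h z := by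
  intro eh fh Sh Rh z hz
  have hp := hh' z hz
  obtain ⟨he1, he3⟩ := deriv_comp_div_deriv hU hV hh hmaps hh' he hz
  obtain ⟨hf1, hf3⟩ := deriv_comp_div_deriv hU hV hh hmaps hh' hf hz
  simp only [eh, fh, Rh, Sh, he1, he3, hf1, hf3]
  field_simp
  ring
end

section
/- Let U, V ⊆ ℂ be open, h : U → V holomorphic with h'(z) ≠ 0 for all z ∈ U, and let g : U → ℂ be holomorphic with g(z)² = h'(z) for all z ∈ U. Let φ, ψ, R : V → ℂ be holomorphic. Define on U: φ̂ := (φ∘h)/g, ψ̂ := (ψ∘h)/g, and R̂ := (R∘h)·(h')² − S(h), where S(h) := h'''/h' − (3/2)(h''/h')² is the Schwarzian derivative. Then for every z ∈ U: φ̂''(z)ψ̂(z) + φ̂(z)ψ̂''(z) − R̂(z)φ̂(z)ψ̂(z) = [ φ''ψ + φψ'' − Rφψ ](h(z)) · h'(z). That is, the integrand of the odd-odd part of the superalgebra cocycle transforms as a differential under holomorphic coordinate change, so that part of the cocycle is well defined. -/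
/-- The second derivative of `f` at a point of an open set on which `f` has derivative `f'`. -/
theorem deriv_iterate_two_eq_of_hasDerivAt {U : Set ℂ} (hU : IsOpen U) {f f' : ℂ → ℂ} {f'' z : ℂ}
    (hf : ∀ w ∈ U, HasDerivAt f (f' w) w) (hz : z ∈ U) (hf' : HasDerivAt f' f'' z) :
    deriv^[2] f z = f'' := by
  have heq : deriv f =ᶠ[nhds z] f' :=
    Filter.eventuallyEq_of_mem (hU.mem_nhds hz) fun w hw => (hf w hw).deriv
  exact heq.deriv_eq.trans hf'.deriv

/-- The second derivative of the pullback `(φ ∘ h) / g` of a `-1/2`-form, where `g ^ 2 = h'`. -/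
theorem deriv_iterate_two_halfForm_pullback {U V : Set ℂ} (hU : IsOpen U) (hV : IsOpen V)
    {h g φ : ℂ → ℂ} (hmaps : Set.MapsTo h U V)
    (hh : ∀ w ∈ U, HasDerivAt h (g w ^ 2) w) (hg : DifferentiableOn ℂ g U)
    (hg0 : ∀ w ∈ U, g w ≠ 0) (hφ : DifferentiableOn ℂ φ V) {z : ℂ} (hz : z ∈ U) :
    deriv^[2] (fun w => φ (h w) / g w) z =
      deriv^[2] φ (h z) * g z ^ 3 -
        φ (h z) * (deriv^[2] g z / g z ^ 2 - 2 * deriv g z ^ 2 / g z ^ 3) := by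
  have hgd : ∀ w ∈ U, HasDerivAt g (deriv g w) w := fun w hw =>
    (hg.differentiableAt (hU.mem_nhds hw)).hasDerivAt
  have hφd : ∀ w ∈ U, HasDerivAt (fun w => φ (h w)) (deriv φ (h w) * g w ^ 2) w := fun w hw =>
    (hφ.differentiableAt (hV.mem_nhds (hmaps hw))).hasDerivAt.comp w (hh w hw)
  have hg' : HasDerivAt (deriv g) (deriv^[2] g z) z :=
    ((hg.deriv hU).differentiableAt (hU.mem_nhds hz)).hasDerivAt
  have hφ' : HasDerivAt (fun w => deriv φ (h w)) (deriv^[2] φ (h z) * g z ^ 2) z :=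
    ((hφ.deriv hV).differentiableAt (hV.mem_nhds (hmaps hz))).hasDerivAt.comp z (hh z hz)
  have hz0 := hg0 z hz
  refine deriv_iterate_two_eq_of_hasDerivAt hU
    (f' := fun w => deriv φ (h w) * g w - φ (h w) * deriv g w / g w ^ 2) (fun w hw => ?_) hz ?_
  · have hw0 := hg0 w hw
    refine ((hφd w hw).fun_div (hgd w hw) hw0).congr_deriv ?_
    field_simp
  · refine ((hφ'.fun_mul (hgd z hz)).fun_sub
      (((hφd z hz).fun_mul hg').fun_div ((hgd z hz).fun_pow 2) (pow_ne_zero 2 hz0))).congr_deriv ?_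
    field_simp
    ring

/-- The integrand of the odd-odd part of the superalgebra cocycle transforms as
a differential under a holomorphic coordinate change `h` with nonvanishing
derivative: with a holomorphic square root `g` of `h'`, `φ̂ = (φ∘h)/g`,
`ψ̂ = (ψ∘h)/g` and `R̂ = (R∘h)·(h')² − S(h)` (`S(h) = h'''/h' − (3/2)(h''/h')²`
the Schwarzian derivative), one has
`φ̂''ψ̂ + φ̂ψ̂'' − R̂φ̂ψ̂ = [φ''ψ + φψ'' − Rφψ]∘h · h'`. -/
theorem halfForm_cocycle_integrand_welldefined
    (U V : Set ℂ) (hU : IsOpen U) (hV : IsOpen V)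
    (h g φ ψ R : ℂ → ℂ)
    (hh : DifferentiableOn ℂ h U) (hmaps : Set.MapsTo h U V)
    (hh' : ∀ z ∈ U, deriv h z ≠ 0)
    (hg : DifferentiableOn ℂ g U) (hg2 : ∀ z ∈ U, g z ^ 2 = deriv h z)
    (hφ : DifferentiableOn ℂ φ V) (hψ : DifferentiableOn ℂ ψ V)
    (hR : DifferentiableOn ℂ R V) :
    let ph : ℂ → ℂ := fun w => φ (h w) / g w
    let psih : ℂ → ℂ := fun w => ψ (h w) / g w
    let Sh : ℂ → ℂ := fun w =>
      deriv^[3] h w / deriv h w - (3/2 : ℂ) * (deriv^[2] h w / deriv h w) ^ 2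
    let Rh : ℂ → ℂ := fun w => R (h w) * (deriv h w) ^ 2 - Sh w
    ∀ z ∈ U,
      deriv^[2] ph z * psih z + ph z * deriv^[2] psih z - Rh z * (ph z * psih z)
      = (deriv^[2] φ (h z) * ψ (h z) + φ (h z) * deriv^[2] ψ (h z)
          - R (h z) * (φ (h z) * ψ (h z))) * deriv h z := by
  intro ph psih Sh Rh z hz
  have hg0 : ∀ w ∈ U, g w ≠ 0 := fun w hw hgw => hh' w hw (by rw [← hg2 w hw, hgw]; ring)
  have hhd : ∀ w ∈ U, HasDerivAt h (g w ^ 2) w := fun w hw => by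
    rw [hg2 w hw]
    exact (hh.differentiableAt (hU.mem_nhds hw)).hasDerivAt
  have hgd : ∀ w ∈ U, HasDerivAt g (deriv g w) w := fun w hw =>
    (hg.differentiableAt (hU.mem_nhds hw)).hasDerivAt
  have hg' : HasDerivAt (deriv g) (deriv^[2] g z) z :=
    ((hg.deriv hU).differentiableAt (hU.mem_nhds hz)).hasDerivAt
  have hh1 : ∀ w ∈ U, HasDerivAt (deriv h) (2 * g w * deriv g w) w := fun w hw =>
    (((hgd w hw).fun_pow 2).congr_deriv (by ring)).congr_of_eventuallyEq
      (Filter.eventuallyEq_of_mem (hU.mem_nhds hw) fun v hv => (hg2 v hv).symm)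
  have hh2 : deriv^[2] h z = 2 * g z * deriv g z := (hh1 z hz).deriv
  have hh3 : deriv^[3] h z = 2 * deriv g z ^ 2 + 2 * g z * deriv^[2] g z :=
    deriv_iterate_two_eq_of_hasDerivAt hU hh1 hz
      ((((hgd z hz).const_mul 2).fun_mul hg').congr_deriv (by ring))
  have hz0 := hg0 z hz
  simp only [ph, psih, Rh, Sh]
  rw [deriv_iterate_two_halfForm_pullback hU hV hmaps hhd hg hg0 hφ hz,
    deriv_iterate_two_halfForm_pullback hU hV hmaps hhd hg hg0 hψ hz, hh2, hh3, ← hg2 z hz]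
  field_simp
  ring
end

section
/- Let c : ℤ × ℤ → ℂ satisfy c(n,m) = −c(m,n) for all n, m, and the Witt cocycle condition (m − n)c(n+m, k) + (k − m)c(m+k, n) + (n − k)c(k+n, m) = 0 for all n, m, k ∈ ℤ. Then there exist λ ∈ ℂ and a function κ : ℤ → ℂ such that c(n,m) = λ(n³ − n)δ_{n+m,0} + (m − n)κ(n+m) for all n, m ∈ ℤ. In other words, every 2-cocycle of the Witt algebra is cohomologous to a scalar multiple of the Virasoro cocycle, so the second Lie algebra cohomology of the Witt algebra with values in ℂ is one-dimensional. -/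
/-- An odd function satisfying the recurrence obeyed by `n ↦ c (n, -n)` is determined by its
values at `1` and `2`. -/
theorem eq_cubic_of_odd_of_recurrence (f : ℤ → ℂ) (hodd : ∀ n, f (-n) = -f n)
    (hrec : ∀ n : ℤ, ((n : ℂ) - 1) * f (n + 1) = ((n : ℂ) + 2) * f n - (2 * (n : ℂ) + 1) * f 1)
    (n : ℤ) :
    f n = (f 2 - 2 * f 1) / 6 * ((n : ℂ) ^ 3 - (n : ℂ)) + (n : ℂ) * f 1 := by
  have hzero : f 0 = 0 := by
    have h := hodd 0
    rw [neg_zero] at h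
    linear_combination h / 2
  have hnat : ∀ k : ℕ, f (k : ℤ) =
      (f 2 - 2 * f 1) / 6 * ((k : ℂ) ^ 3 - (k : ℂ)) + (k : ℂ) * f 1 := by
    intro k
    induction k with
    | zero => simp [hzero]
    | succ k ih =>
      by_cases hk : k = 1
      · subst hk
        norm_num
      · have hk' : (k : ℂ) - 1 ≠ 0 := sub_ne_zero.mpr (by exact_mod_cast hk)
        have h := hrec k
        push_cast at h ⊢
        apply mul_left_cancel₀ hk'
        linear_combination h + ((k : ℂ) + 2) * ih
  obtain ⟨k, rfl | rfl⟩ := n.eq_nat_or_neg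
  · simpa using hnat k
  · rw [hodd, hnat k]
    push_cast
    ring


/-- Classification of 2-cocycles of the Witt algebra: every antisymmetric
`c : ℤ × ℤ → ℂ` satisfying the Witt cocycle condition
`(m − n)c(n+m,k) + (k − m)c(m+k,n) + (n − k)c(k+n,m) = 0` is of the form
`c(n,m) = λ(n³ − n)δ_{n+m,0} + (m − n)κ(n+m)`, i.e. cohomologous to a scalar
multiple of the Virasoro cocycle; hence `H²(Witt, ℂ)` is one-dimensional. -/
theorem witt_cocycle_classification (c : ℤ × ℤ → ℂ)
    (hskew : ∀ n m : ℤ, c (n, m) = -c (m, n))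
    (hcoc : ∀ n m k : ℤ,
      ((m : ℂ) - (n : ℂ)) * c (n + m, k) + ((k : ℂ) - (m : ℂ)) * c (m + k, n)
        + ((n : ℂ) - (k : ℂ)) * c (k + n, m) = 0) :
    ∃ (lam : ℂ) (κ : ℤ → ℂ), ∀ n m : ℤ,
      c (n, m) = lam * ((n : ℂ) ^ 3 - (n : ℂ)) * (if n + m = 0 then 1 else 0)
        + ((m : ℂ) - (n : ℂ)) * κ (n + m) := by
  have hdiag := eq_cubic_of_odd_of_recurrence (fun n => c (n, -n))
    (fun n => by simpa using hskew (-n) n)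
    (fun n => by
      have h := hcoc n 1 (-(n + 1))
      rw [show (1 : ℤ) + -(n + 1) = -n by ring, show -(n + 1) + n = -1 by ring,
        hskew (-n) n, hskew (-1) 1] at h
      push_cast at h
      linear_combination -h)
  refine ⟨(c (2, -2) - 2 * c (1, -1)) / 6,
    fun s => if s = 0 then -c (1, -1) / 2 else -c (s, 0) / (s : ℂ), fun n m => ?_⟩
  by_cases hs : n + m = 0
  · obtain rfl : m = -n := by omega
    have h := hdiag n
    simp only [add_neg_cancel, if_true]
    push_cast
    linear_combination h
  · have hs' : (n : ℂ) + (m : ℂ) ≠ 0 := by exact_mod_cast hs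
    have h := hcoc n m 0
    rw [add_zero, zero_add, hskew m n] at h
    simp only [if_neg hs, mul_zero, zero_add]
    push_cast at h ⊢
    field_simp
    linear_combination h
end

section
/- Let c : ℤ × ℤ → ℂ satisfy c(a,b) = c(b,a) for all a, b ∈ ℤ, and suppose that for all k, a, b ∈ ℤ: (2b + 1 − k)·c(a, b+k) + (2a + 1 − k)·c(b, a+k) = 0. Then c is identically zero. (Interpreting c(a,b) as the value of a super-cocycle on the pair of odd elements (φ_{a+1/2}, φ_{b+1/2}) of the classical Neveu–Schwarz type superalgebra, the hypothesis is exactly the super-cocycle condition c(e_k,[φ,ψ]) − c(φ, e_k.ψ) − c(ψ, e_k.φ) = 0 for a cocycle vanishing on the vector field subalgebra, since e_k.φ_{b+1/2} = (b + 1/2 − k/2)φ_{b+1/2+k}; the conclusion is that a cocycle of the superalgebra which vanishes on the vector field subalgebra vanishes in total.) -/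
/-- A super-cocycle of the classical Neveu–Schwarz type superalgebra which
vanishes on the vector field subalgebra vanishes in total: if `c : ℤ × ℤ → ℂ`
(with `c(a,b)` the value on the odd pair `(φ_{a+1/2}, φ_{b+1/2})`) is symmetric
and satisfies `(2b + 1 − k)·c(a, b+k) + (2a + 1 − k)·c(b, a+k) = 0` for all
`k, a, b`, then `c` is identically zero. -/
theorem supercocycle_vanishing_on_vectorFields (c : ℤ × ℤ → ℂ)
    (hsymm : ∀ a b : ℤ, c (a, b) = c (b, a))
    (hcoc : ∀ k a b : ℤ,
      (2 * (b : ℂ) + 1 - (k : ℂ)) * c (a, b + k)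
        + (2 * (a : ℂ) + 1 - (k : ℂ)) * c (b, a + k) = 0) :
    ∀ a b : ℤ, c (a, b) = 0 := by
  intro a b
  have h_diag := hcoc (b - a) a a
  have h_weight := hcoc 0 a b
  rw [add_sub_cancel] at h_diag
  rw [add_zero, add_zero, hsymm b a] at h_weight
  push_cast at h_diag h_weight
  have h_ne : (2 * (a : ℂ) + 1) ≠ 0 := by
    have : 2 * a + 1 ≠ 0 := by omega
    exact_mod_cast this
  have h_mul : (2 * (a : ℂ) + 1) * c (a, b) = 0 := by
    linear_combination (1 / 4 : ℂ) * h_diag + (1 / 4 : ℂ) * h_weight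
  exact (mul_eq_zero.mp h_mul).resolve_left h_ne
end

section
/- Let c_L : ℤ × ℤ → ℂ and c_F : ℤ × ℤ → ℂ satisfy: (i) c_L(n,m) = −c_L(m,n) and the Witt cocycle condition (m − n)c_L(n+m, k) + (k − m)c_L(m+k, n) + (n − k)c_L(k+n, m) = 0 for all n, m, k ∈ ℤ; (ii) c_F(a,b) = c_F(b,a) for all a, b ∈ ℤ; (iii) 2·c_L(k, a+b+1) − (2b + 1 − k)·c_F(a, b+k) − (2a + 1 − k)·c_F(b, a+k) = 0 for all k, a, b ∈ ℤ. Then there exist λ ∈ ℂ and a function κ : ℤ → ℂ such that for all n, m, a, b ∈ ℤ: c_L(n,m) = λ(n³ − n)δ_{n+m,0} + (m − n)κ(n+m) and c_F(a,b) = −2λ·a(a+1)·δ_{a+b+1,0} + κ(a+b+1). In other words, up to equivalence and rescaling there is only one nontrivial central extension with even central element of the classical Neveu–Schwarz type Krichever–Novikov superalgebra: the space of cohomology classes of such cocycles is one-dimensional, generated by the standard cocycle. -/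
/-- A function on `ℤ` which is symmetric under `a ↦ -a - 1` and satisfies the degree-zero recursion
of a Neveu–Schwarz cocycle is quadratic. -/
theorem eq_quadratic_of_recursion (g : ℤ → ℂ) (hsymm : ∀ a, g (-a - 1) = g a)
    (hrec : ∀ n : ℤ, (3 * (n : ℂ) + 5) * g 0 + ((n : ℂ) + 3) * g (n + 1)
      = ((n : ℂ) + 5) * g n + (3 * (n : ℂ) + 3) * g 1) (a : ℤ) :
    g a = -2 * ((g 0 - g 1) / 4) * ((a : ℂ) * ((a : ℂ) + 1)) + g 0 := by
  have hnat : ∀ n : ℕ,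
      g n = -2 * ((g 0 - g 1) / 4) * ((n : ℂ) * ((n : ℂ) + 1)) + g 0 := by
    intro n
    induction n with
    | zero => simp
    | succ n ih =>
      have h := hrec n
      have hn : (n : ℂ) + 3 ≠ 0 := by exact_mod_cast Nat.succ_ne_zero (n + 2)
      rw [ih] at h
      push_cast at h ⊢
      apply mul_left_cancel₀ hn
      linear_combination h
  rcases le_or_gt 0 a with ha | ha
  · lift a to ℕ using ha
    exact_mod_cast hnat a
  · obtain ⟨n, hn⟩ := Int.eq_ofNat_of_zero_le (show 0 ≤ -a - 1 by omega)
    obtain rfl : a = -(n : ℤ) - 1 := by omega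
    rw [hsymm, hnat]
    push_cast
    ring


/-- Uniqueness of the nontrivial central extension with even central element of
the classical Neveu–Schwarz type Krichever–Novikov superalgebra: every
super-cocycle, encoded by `c_L(n,m) = c(e_n,e_m)` and
`c_F(a,b) = c(φ_{a+1/2},φ_{b+1/2})` satisfying the super-cocycle conditions
(i)–(iii), is a multiple of the standard cocycle plus a coboundary:
`c_L(n,m) = λ(n³−n)δ_{n+m,0} + (m−n)κ(n+m)` and
`c_F(a,b) = −2λ·a(a+1)·δ_{a+b+1,0} + κ(a+b+1)`. -/
theorem neveuSchwarz_cocycle_classification (cL cF : ℤ × ℤ → ℂ)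
    (hLskew : ∀ n m : ℤ, cL (n, m) = -cL (m, n))
    (hLcoc : ∀ n m k : ℤ,
      ((m : ℂ) - (n : ℂ)) * cL (n + m, k) + ((k : ℂ) - (m : ℂ)) * cL (m + k, n)
        + ((n : ℂ) - (k : ℂ)) * cL (k + n, m) = 0)
    (hFsymm : ∀ a b : ℤ, cF (a, b) = cF (b, a))
    (hmix : ∀ k a b : ℤ,
      2 * cL (k, a + b + 1) - (2 * (b : ℂ) + 1 - (k : ℂ)) * cF (a, b + k)
        - (2 * (a : ℂ) + 1 - (k : ℂ)) * cF (b, a + k) = 0) :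
    ∃ (lam : ℂ) (κ : ℤ → ℂ),
      (∀ n m : ℤ,
        cL (n, m) = lam * ((n : ℂ) ^ 3 - (n : ℂ)) * (if n + m = 0 then 1 else 0)
          + ((m : ℂ) - (n : ℂ)) * κ (n + m)) ∧
      (∀ a b : ℤ,
        cF (a, b) = -2 * lam * ((a : ℂ) * ((a : ℂ) + 1)) * (if a + b + 1 = 0 then 1 else 0)
          + κ (a + b + 1)) := by
  have hcF : ∀ a b : ℤ, a + b + 1 ≠ 0 →
      cF (a, b) = cL (0, a + b + 1) / ((a + b + 1 : ℤ) : ℂ) := by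
    intro a b hs
    have h := hmix 0 a b
    rw [add_zero, add_zero, hFsymm b a] at h
    rw [eq_div_iff (Int.cast_ne_zero.mpr hs)]
    push_cast at h ⊢
    linear_combination -h / 2
  have hcL : ∀ n m : ℤ, n + m ≠ 0 →
      cL (n, m) = ((m : ℂ) - n) * (cL (0, n + m) / ((n + m : ℤ) : ℂ)) := by
    intro n m hs
    have h := hLcoc n m 0
    rw [add_zero, zero_add, hLskew (n + m) 0, hLskew m n] at h
    rw [← mul_div_assoc, eq_div_iff (Int.cast_ne_zero.mpr hs)]
    push_cast at h ⊢
    linear_combination h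
  have hdeg : ∀ a b : ℤ, 2 * cL (-(a + b + 1), a + b + 1)
      = (3 * (b : ℂ) + a + 2) * cF (a, -a - 1) + (3 * (a : ℂ) + b + 2) * cF (b, -b - 1) := by
    intro a b
    have h := hmix (-(a + b + 1)) a b
    rw [show b + -(a + b + 1) = -a - 1 by ring, show a + -(a + b + 1) = -b - 1 by ring] at h
    push_cast at h
    linear_combination h
  have hquad := eq_quadratic_of_recursion (fun a => cF (a, -a - 1))
    (fun a => by
      rw [hFsymm, show -(-a - 1) - 1 = a by ring])
    (fun n => by
      have h₀ := hdeg (n + 1) 0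
      have h₁ := hdeg n 1
      rw [add_zero] at h₀
      simp only [Int.cast_add, Int.cast_one, Int.cast_zero] at h₀ h₁
      linear_combination h₁ - h₀)
  set g₀ := cF (0, -0 - 1)
  set lam := (g₀ - cF (1, -1 - 1)) / 4
  refine ⟨lam, fun s => if s = 0 then g₀ else cL (0, s) / (s : ℂ), fun n m => ?_, fun a b => ?_⟩
  · by_cases hs : n + m = 0
    · obtain rfl : m = -n := by omega
      have h := hdeg 0 (-n - 1)
      rw [hquad 0, hquad (-n - 1), show (0 : ℤ) + (-n - 1) + 1 = -n by ring, neg_neg] at h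
      simp only [add_neg_cancel, if_true]
      push_cast at h ⊢
      linear_combination h / 2
    · simp only [hs, if_false, mul_zero, zero_add]
      exact hcL n m hs
  · by_cases hs : a + b + 1 = 0
    · obtain rfl : b = -a - 1 := by omega
      simpa only [hs, if_true, mul_one] using hquad a
    · simp only [hs, if_false, mul_zero, zero_add]
      exact hcF a b hs
end

section
/- Let c : ℤ × ℤ → ℂ (where c(n,a) represents the value of an odd super-cocycle on the pair (e_n, φ_{a+1/2})) satisfy: (i) for all n, m, a ∈ ℤ: (2a + 1 − m)·c(n, a+m) − (2a + 1 − n)·c(m, a+n) − 2(m − n)·c(n+m, a) = 0; (ii) for all a, b, d ∈ ℤ: c(b+d+1, a) + c(d+a+1, b) + c(a+b+1, d) = 0; (iii) c is bounded from above: there exists N ∈ ℤ such that c(n,a) = 0 whenever n + a ≥ N. Then c is a coboundary: there exists κ : ℤ → ℂ such that 2·c(n,a) = (2a + 1 − n)·κ(n+a) for all n, a ∈ ℤ. Consequently, every central extension of the classical Neveu–Schwarz type superalgebra with odd central element defined by a bounded cocycle splits. -/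
/-- Every bounded cocycle of the classical Neveu–Schwarz type superalgebra with
odd central element is a coboundary (so the corresponding central extension
splits): if `c : ℤ × ℤ → ℂ` (with `c(n,a)` the value on `(e_n, φ_{a+1/2})`)
satisfies the (even,even,odd) condition (i), the (odd,odd,odd) condition (ii),
and is bounded from above (iii), then there is `κ : ℤ → ℂ` with
`2c(n,a) = (2a + 1 − n)κ(n+a)`. -/
theorem odd_central_element_cocycle_is_coboundary (c : ℤ × ℤ → ℂ)
    (h1 : ∀ n m a : ℤ,
      (2 * (a : ℂ) + 1 - (m : ℂ)) * c (n, a + m)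
        - (2 * (a : ℂ) + 1 - (n : ℂ)) * c (m, a + n)
        - 2 * ((m : ℂ) - (n : ℂ)) * c (n + m, a) = 0)
    (h2 : ∀ a b d : ℤ, c (b + d + 1, a) + c (d + a + 1, b) + c (a + b + 1, d) = 0)
    (h3 : ∃ N : ℤ, ∀ n a : ℤ, n + a ≥ N → c (n, a) = 0) :
    ∃ κ : ℤ → ℂ, ∀ n a : ℤ,
      2 * c (n, a) = (2 * (a : ℂ) + 1 - (n : ℂ)) * κ (n + a) := by
  refine ⟨fun s => 2 * c (0, s) / (2 * (s : ℂ) + 1), fun n a => ?_⟩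
  have h_odd : 2 * ((n + a : ℤ) : ℂ) + 1 ≠ 0 := by
    have h : 2 * (n + a) + 1 ≠ 0 := by omega
    exact_mod_cast h
  have h := h1 0 n a
  rw [add_zero, zero_add, add_comm a n] at h
  rw [mul_div_assoc', eq_div_iff h_odd]
  push_cast at h ⊢
  linear_combination -2 * h
end
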